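/- arXiv:1808.03411 — 7 statements merged into one kernel-verified Lean document; each statement's English description precedes it below -/
import Mathlib

section
/- Suppose x_i ≠ 1 for all i = 1, …, n, and let S = Σ_{i=1}^n 1/(1 − x_i). Then M is nonsingular if and only if S ≠ 1. -/
open Matrix BigOperators

/-- `Mmat x` is the matrix with diagonal entries `x i` and all off-diagonal entries `1`. -/
def Mmat {n : ℕ} (x : Fin n → ℝ) : Matrix (Fin n) (Fin n) ℝ :=
  Matrix.of fun i j => if i = j then x i else 1

/-- The determinant of `Mmat x`, by the matrix determinant lemma. -/
theorem det_Mmat {n : ℕ} (x : Fin n → ℝ) (hx : ∀ i, x i ≠ 1) :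
    (Mmat x).det = (∏ i, (x i - 1)) * (1 - ∑ i, 1 / (1 - x i)) := by
  have hM : Mmat x = diagonal (fun i => x i - 1) *
      (1 + replicateCol Unit (fun i => (x i - 1)⁻¹) * replicateRow Unit (fun _ => (1 : ℝ))) := by
    ext i j
    have hi : x i - 1 ≠ 0 := sub_ne_zero.mpr (hx i)
    rw [diagonal_mul]
    by_cases hij : i = j
    · subst hij
      simp [Mmat, mul_apply, mul_add, hi]
    · simp [Mmat, mul_apply, hij, hi]
  rw [hM, det_mul, det_diagonal, det_one_add_replicateCol_mul_replicateRow, sub_eq_add_neg 1,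
    ← Finset.sum_neg_distrib]
  congr 2
  refine Finset.sum_congr rfl fun i _ => ?_
  rw [one_mul, one_div, ← neg_sub (x i) 1, inv_neg, neg_neg]

/-- if `x i ≠ 1` for all `i` and `S = ∑ i, 1/(1 - x i)`, then `M` is
nonsingular if and only if `S ≠ 1`. -/
theorem stmt_2 {n : ℕ} (hn : 1 ≤ n) (x : Fin n → ℝ) (hx : ∀ i, x i ≠ 1) :
    (Mmat x).det ≠ 0 ↔ (∑ i, 1 / (1 - x i)) ≠ 1 := by
  rw [det_Mmat x hx, mul_ne_zero_iff, sub_ne_zero, ne_comm (a := (1 : ℝ))]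
  exact and_iff_right (Finset.prod_ne_zero_iff.mpr fun i _ => sub_ne_zero.mpr (hx i))
end

section
/- Suppose x_i ≠ 1 for all i = 1, …, n, and S = Σ_{i=1}^n 1/(1 − x_i) equals 1. Then for every real number x_{n+1}, the (n+1)×(n+1) bordered matrix M̃(x_{n+1}) is nonsingular. -/
open Matrix BigOperators

/-- `Mtilde x α` is the bordered matrix whose top-left block is `Mmat x`, whose last row and
column are all ones, except the bottom-right corner entry which is `α`. -/
def Mtilde {n : ℕ} (x : Fin n → ℝ) (α : ℝ) : Matrix (Fin n ⊕ Unit) (Fin n ⊕ Unit) ℝ :=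
  Matrix.fromBlocks (Mmat x) (fun _ _ => 1) (fun _ _ => 1) (fun _ _ => α)

/-- if `x i ≠ 1` for all `i` and `∑ i, 1/(1 - x i) = 1`, then for every real
`α` the bordered matrix `M̃(α)` is nonsingular. -/
theorem stmt_3 {n : ℕ} (hn : 1 ≤ n) (x : Fin n → ℝ) (hx : ∀ i, x i ≠ 1)
    (hS : (∑ i, 1 / (1 - x i)) = 1) (α : ℝ) :
    (Mtilde x α).det ≠ 0 := by
  intro hdet
  obtain ⟨v, hv, hMv⟩ := Matrix.exists_mulVec_eq_zero_iff.mpr hdet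
  have hx' : ∀ i, 1 - x i ≠ 0 := fun i => sub_ne_zero.mpr (hx i).symm
  set σ := ∑ j, v (Sum.inl j) with hσ
  set t := v (Sum.inr ()) with ht
  have hrow : ∀ i, v (Sum.inl i) = (σ + t) * (1 / (1 - x i)) := by
    intro i
    have h := congrFun hMv (Sum.inl i)
    have hsum : ∑ j, (if i = j then x i else 1) * v (Sum.inl j)
        = σ + (x i - 1) * v (Sum.inl i) := by
      have hterm : ∀ j, (if i = j then x i else 1) * v (Sum.inl j)
          = v (Sum.inl j) + if i = j then (x i - 1) * v (Sum.inl j) else 0 := by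
        intro j
        split_ifs <;> ring
      simp only [hterm, Finset.sum_add_distrib, Finset.sum_ite_eq, Finset.mem_univ, if_true, hσ]
    rw [Matrix.mulVec, dotProduct, Fintype.sum_sum_type, Fintype.sum_unique (ι := Unit)] at h
    change ∑ j, (if i = j then x i else 1) * v (Sum.inl j) + 1 * t = 0 at h
    rw [hsum] at h
    rw [mul_one_div, eq_div_iff (hx' i)]
    linarith
  have hlast : σ + α * t = 0 := by
    have h := congrFun hMv (Sum.inr ())
    rw [Matrix.mulVec, dotProduct, Fintype.sum_sum_type, Fintype.sum_unique (ι := Unit)] at h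
    change ∑ j, 1 * v (Sum.inl j) + α * t = 0 at h
    simpa only [one_mul] using h
  have hsum : σ = σ + t := by
    calc σ = ∑ i, (σ + t) * (1 / (1 - x i)) := Finset.sum_congr rfl fun i _ => hrow i
      _ = σ + t := by rw [← Finset.mul_sum, hS, mul_one]
  have ht0 : t = 0 := by linarith
  have hσ0 : σ = 0 := by simpa [ht0] using hlast
  refine hv (funext ?_)
  rintro (i | ⟨⟩)
  · simp [hrow i, hσ0, ht0]
  · exact ht0
end

section
/- Suppose x_i ≠ 1 for all i = 1, …, n, and S = Σ_{i=1}^n 1/(1 − x_i) satisfies S ≠ 1. Then for every real number α, det M̃(α) = (α − S/(S−1)) · det M. -/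
open Matrix BigOperators

/-- If `A * c = B` then a bordered matrix with blocks `A, B, C, D` has determinant
`det A * det (D - C * c)`, whether or not `A` is invertible. -/
theorem det_fromBlocks_of_mul_eq {m k R : Type*} [Fintype m] [DecidableEq m] [Fintype k]
    [DecidableEq k] [CommRing R] {A : Matrix m m R} {B : Matrix m k R} (C : Matrix k m R)
    (D : Matrix k k R) {c : Matrix m k R} (h : A * c = B) :
    (fromBlocks A B C D).det = A.det * (D - C * c).det := by
  have key : fromBlocks A B C D = fromBlocks A 0 C (D - C * c) * fromBlocks 1 c 0 1 := by
    simp [fromBlocks_multiply, h]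
  rw [key, det_mul, det_fromBlocks_zero₁₂, det_fromBlocks_zero₂₁]
  simp

theorem Mmat_mulVec {n : ℕ} (x v : Fin n → ℝ) (i : Fin n) :
    (Mmat x *ᵥ v) i = ∑ j, v j - (1 - x i) * v i := by
  have h (j : Fin n) : (if i = j then x i else 1) * v j
      = v j - if i = j then (1 - x i) * v i else 0 := by
    split_ifs with hij
    · subst hij; ring
    · ring
  simp [Mmat, mulVec, dotProduct, h]

/-- if `x i ≠ 1` for all `i` and `S = ∑ i, 1/(1 - x i) ≠ 1`, then for every
real `α`, `det M̃(α) = (α - S/(S-1)) * det M`. -/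
theorem stmt_4 {n : ℕ} (hn : 1 ≤ n) (x : Fin n → ℝ) (hx : ∀ i, x i ≠ 1)
    (S : ℝ) (hS : S = ∑ i, 1 / (1 - x i)) (hS1 : S ≠ 1) (α : ℝ) :
    (Mtilde x α).det = (α - S / (S - 1)) * (Mmat x).det := by
  have hS0 : S - 1 ≠ 0 := sub_ne_zero.mpr hS1
  let v : Fin n → ℝ := fun i => 1 / (1 - x i) / (S - 1)
  have hv : ∑ i, v i = S / (S - 1) := by rw [← Finset.sum_div, ← hS]
  have hc : Mmat x * replicateCol Unit v = (fun _ _ => 1 : Matrix (Fin n) Unit ℝ) := by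
    ext i j
    change (Mmat x *ᵥ v) i = 1
    have hi : 1 - x i ≠ 0 := sub_ne_zero.mpr (hx i).symm
    rw [Mmat_mulVec, hv]
    simp only [v]
    field_simp
  refine (det_fromBlocks_of_mul_eq _ _ hc).trans ?_
  rw [mul_comm, det_unique (n := Unit), ← hv]
  congr 1
  change α - ∑ i, 1 * v i = _
  simp only [one_mul]
end

section
/- Suppose exactly one of x_1, …, x_n equals 1 (say x_1 = 1 and x_i ≠ 1 for all i ≥ 2). Then for every real number α, det M̃(α) = (α − 1) · det M. -/
open Matrix BigOperators

/-- if exactly one of the `x i` equals `1` (the one with index `i₀`), then for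
every real `α`, `det M̃(α) = (α - 1) * det M`. -/
theorem stmt_5 {n : ℕ} (x : Fin n → ℝ) (i₀ : Fin n)
    (h1 : x i₀ = 1) (h2 : ∀ i, i ≠ i₀ → x i ≠ 1) (α : ℝ) :
    (Mtilde x α).det = (α - 1) * (Mmat x).det := by
  have hM (j : Fin n) : Mmat x i₀ j = 1 := by
    simp only [Mmat, Matrix.of_apply]
    split_ifs
    exacts [h1, rfl]
  have hrow : (Mtilde x α).updateRow (Sum.inr ())
      (Mtilde x α (Sum.inr ()) + (-1 : ℝ) • Mtilde x α (Sum.inl i₀)) =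
      Matrix.fromBlocks (Mmat x) (Matrix.of fun _ _ => 1) 0 (Matrix.of fun _ _ => α - 1) := by
    ext (i | i) (j | j)
    · rw [Matrix.updateRow_ne Sum.inl_ne_inr]
      rfl
    · rw [Matrix.updateRow_ne Sum.inl_ne_inr]
      rfl
    · rw [Matrix.updateRow_self]
      change 1 + (-1) * Mmat x i₀ j = 0
      rw [hM]
      norm_num
    · rw [Matrix.updateRow_self]
      change α + (-1) * 1 = α - 1
      ring
  rw [← Matrix.det_updateRow_add_smul_self (Mtilde x α)
    (Sum.inr_ne_inl : Sum.inr () ≠ Sum.inl i₀) (-1), hrow, Matrix.det_fromBlocks_zero₂₁,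
    Matrix.det_unique (n := Unit), Matrix.of_apply, mul_comm]
end

section
/- Let A be an n₁×n₁ real matrix, C a n₂×n₂ real matrix, b ∈ ℝ^{n₁}, c ∈ ℝ^{n₂}, and α ∈ ℝ. Let N be the (n₁+1+n₂)×(n₁+1+n₂) block matrix N = [[A, b, O],[bᵀ, α, cᵀ],[O, c, C]], where O denotes zero blocks. Then det N = det([[A, b],[bᵀ, α]]) · det C + det A · det([[α, cᵀ],[c, C]]) − α · det A · det C. (This is the determinant formula for a coalescence of two weighted graphs at a vertex carrying a loop of weight α.) -/
open Matrix BigOperators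

theorem Matrix.det_eq_add_of_row_eq_add {n R : Type*} [Fintype n] [DecidableEq n] [CommRing R]
    {M M₁ M₂ : Matrix n n R} (k : n) (hk : ∀ j, M k j = M₁ k j + M₂ k j)
    (h₁ : ∀ i, i ≠ k → ∀ j, M₁ i j = M i j) (h₂ : ∀ i, i ≠ k → ∀ j, M₂ i j = M i j) :
    M.det = M₁.det + M₂.det := by
  have key := det_updateRow_add M k (M₁ k) (M₂ k)
  have e : M.updateRow k (M₁ k + M₂ k) = M := by
    ext i j
    by_cases h : i = k
    · subst h; simp [hk]
    · simp [h]
  have e₁ : M.updateRow k (M₁ k) = M₁ := by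
    ext i j
    by_cases h : i = k
    · subst h; simp
    · simp [h, h₁]
  have e₂ : M.updateRow k (M₂ k) = M₂ := by
    ext i j
    by_cases h : i = k
    · subst h; simp
    · simp [h, h₂]
  rwa [e, e₁, e₂] at key

/-- determinant formula for a coalescence at a vertex with a loop of weight
`α`: `det N = det [[A,b],[bᵀ,α]] ⬝ det C + det A ⬝ det [[α,cᵀ],[c,C]] - α ⬝ det A ⬝ det C`,
where `N = [[A, b, O],[bᵀ, α, cᵀ],[O, c, C]]`. -/
theorem stmt_9 {n₁ n₂ : ℕ} (A : Matrix (Fin n₁) (Fin n₁) ℝ) (C : Matrix (Fin n₂) (Fin n₂) ℝ)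
    (b : Fin n₁ → ℝ) (c : Fin n₂ → ℝ) (α : ℝ) :
    (Matrix.fromBlocks
        (Matrix.fromBlocks A (fun i _ => b i) (fun _ j => b j) (fun _ _ => α))
        (Matrix.of fun p (j : Fin n₂) => Sum.elim (fun _ : Fin n₁ => (0 : ℝ)) (fun _ : Unit => c j) p)
        (Matrix.of fun (i : Fin n₂) p => Sum.elim (fun _ : Fin n₁ => (0 : ℝ)) (fun _ : Unit => c i) p)
        C).det =
      (Matrix.fromBlocks A (fun i _ => b i) (fun _ j => b j)
          (fun _ _ : Unit => α)).det * C.det +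
        A.det * (Matrix.fromBlocks (fun _ _ : Unit => α) (fun _ j => c j)
          (fun i _ => c i) C).det -
        α * A.det * C.det := by
  have hN := Matrix.det_eq_add_of_row_eq_add
    (M := Matrix.fromBlocks
        (Matrix.fromBlocks A (fun i _ => b i) (fun _ j => b j) (fun _ _ => α))
        (Matrix.of fun p (j : Fin n₂) => Sum.elim (fun _ : Fin n₁ => (0 : ℝ)) (fun _ : Unit => c j) p)
        (Matrix.of fun (i : Fin n₂) p => Sum.elim (fun _ : Fin n₁ => (0 : ℝ)) (fun _ : Unit => c i) p)
        C)
    (M₁ := Matrix.fromBlocks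
        (Matrix.fromBlocks A (fun i _ => b i) (fun _ j => b j) (fun _ _ => α))
        0
        (Matrix.of fun (i : Fin n₂) p => Sum.elim (fun _ : Fin n₁ => (0 : ℝ)) (fun _ : Unit => c i) p)
        C)
    (M₂ := (Matrix.fromBlocks A
        (Matrix.of fun i p => Sum.elim (fun _ : Unit => b i) (fun _ : Fin n₂ => (0 : ℝ)) p) 0
        (Matrix.fromBlocks (fun _ _ : Unit => 0) (fun _ j => c j) (fun i _ => c i) C)).submatrix
        (Equiv.sumAssoc _ _ _) (Equiv.sumAssoc _ _ _))
    (Sum.inl (Sum.inr ()))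
    (by rintro ((j | j) | j) <;> simp [fromBlocks])
    (by rintro ((i | i) | i) hi ((j | j) | j) <;> simp_all [fromBlocks])
    (by rintro ((i | i) | i) hi ((j | j) | j) <;> simp_all [fromBlocks])
  have hG₂ := Matrix.det_eq_add_of_row_eq_add
    (M := Matrix.fromBlocks (fun _ _ : Unit => α) (fun _ j => c j) (fun i _ => c i) C)
    (M₁ := Matrix.fromBlocks (fun _ _ : Unit => α) 0 (fun i _ => c i) C)
    (M₂ := Matrix.fromBlocks (fun _ _ : Unit => 0) (fun _ j => c j) (fun i _ => c i) C)
    (Sum.inl ())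
    (by rintro (j | j) <;> simp [fromBlocks])
    (by rintro (i | i) hi (j | j) <;> simp_all [fromBlocks])
    (by rintro (i | i) hi (j | j) <;> simp_all [fromBlocks])
  rw [det_fromBlocks_zero₁₂, det_submatrix_equiv_self, det_fromBlocks_zero₂₁] at hN
  have hα : (Matrix.fromBlocks (fun _ _ : Unit => α) 0 (fun i _ => c i) C).det = α * C.det :=
    (det_fromBlocks_zero₁₂ (Matrix.of fun _ _ : Unit => α) (Matrix.of fun i _ => c i) C).trans
      (by rw [det_unique, of_apply])
  rw [hN, hG₂, hα]
  ring
end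

section
/- Suppose exactly one of x_1, …, x_n equals 1 (say x_1 = 1 and x_i ≠ 1 for all i ≥ 2). Then for every real number α, every k ≥ 0, every vector w ∈ ℝ^k and every k×k real matrix C, det N = det M · det([[α − 1, wᵀ],[w, C]]), where N = [[M, j, O],[jᵀ, α, wᵀ],[O, w, C]]. In particular, N is nonsingular if and only if [[α − 1, wᵀ],[w, C]] is nonsingular. -/
open Matrix BigOperators

/-- `Nmat x α w C` is the block matrix `[[M, j, O],[jᵀ, α, wᵀ],[O, w, C]]`. -/
def Nmat {n k : ℕ} (x : Fin n → ℝ) (α : ℝ) (w : Fin k → ℝ)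
    (C : Matrix (Fin k) (Fin k) ℝ) :
    Matrix ((Fin n ⊕ Unit) ⊕ Fin k) ((Fin n ⊕ Unit) ⊕ Fin k) ℝ :=
  Matrix.fromBlocks
    (Matrix.fromBlocks (Mmat x) (fun _ _ => 1) (fun _ _ => 1) (fun _ _ => α))
    (Matrix.of fun p (j : Fin k) => Sum.elim (fun _ : Fin n => (0 : ℝ)) (fun _ : Unit => w j) p)
    (Matrix.of fun (i : Fin k) p => Sum.elim (fun _ : Fin n => (0 : ℝ)) (fun _ : Unit => w i) p)
    C

/-- `Smat β w C` is the bordered matrix `[[β, wᵀ],[w, C]]`. -/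
def Smat {k : ℕ} (β : ℝ) (w : Fin k → ℝ) (C : Matrix (Fin k) (Fin k) ℝ) :
    Matrix (Unit ⊕ Fin k) (Unit ⊕ Fin k) ℝ :=
  Matrix.fromBlocks (fun _ _ => β) (fun _ j => w j) (fun i _ => w i) C

/-- Schur complement formula for the determinant with the off-diagonal blocks given as multiples
of the upper left block, which need not be invertible. -/
theorem det_fromBlocks_mul_mul {m p R : Type*} [Fintype m] [Fintype p] [DecidableEq m]
    [DecidableEq p] [CommRing R] (A : Matrix m m R) (E : Matrix m p R) (F : Matrix p m R)
    (D : Matrix p p R) :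
    (fromBlocks A (A * E) (F * A) D).det = A.det * (D - F * A * E).det := by
  have h : fromBlocks A (A * E) (F * A) D =
      fromBlocks 1 0 F 1 * fromBlocks A 0 0 (D - F * A * E) * fromBlocks 1 E 0 1 := by
    simp [fromBlocks_multiply]
  rw [h, det_mul, det_mul, det_fromBlocks_zero₁₂, det_fromBlocks_zero₂₁, det_fromBlocks_zero₂₁]
  simp

theorem Mmat_mulVec_apply {n : ℕ} (x v : Fin n → ℝ) (i : Fin n) :
    (Mmat x *ᵥ v) i = ∑ j, v j + (x i - 1) * v i := by
  have h : ∀ j, Mmat x i j * v j = v j + if i = j then (x i - 1) * v j else 0 := by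
    intro j
    by_cases hij : i = j
    · simp only [Mmat, of_apply, if_pos hij]
      ring
    · simp [Mmat, hij]
  simp [mulVec, dotProduct, h, Finset.sum_add_distrib]

theorem det_Mmat_ne_zero {n : ℕ} (x : Fin n → ℝ) (i₀ : Fin n)
    (h1 : x i₀ = 1) (h2 : ∀ i, i ≠ i₀ → x i ≠ 1) : (Mmat x).det ≠ 0 := by
  intro hdet
  obtain ⟨v, hv, hMv⟩ := exists_mulVec_eq_zero_iff.mpr hdet
  have hrow : ∀ i, ∑ j, v j + (x i - 1) * v i = 0 := fun i => by
    rw [← Mmat_mulVec_apply, hMv, Pi.zero_apply]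
  have hsum : ∑ j, v j = 0 := by simpa [h1] using hrow i₀
  have hne : ∀ i, i ≠ i₀ → v i = 0 := fun i hi => by
    simpa [hsum, sub_eq_zero, h2 i hi] using hrow i
  have h0 : v i₀ = 0 := by
    rwa [Finset.sum_eq_single i₀ (fun i _ hi => hne i hi) (by simp)] at hsum
  refine hv (funext fun i => ?_)
  by_cases hi : i = i₀
  · rw [hi, h0, Pi.zero_apply]
  · exact hne i hi

theorem det_Nmat {n k : ℕ} (x : Fin n → ℝ) (i₀ : Fin n) (h1 : x i₀ = 1)
    (α : ℝ) (w : Fin k → ℝ) (C : Matrix (Fin k) (Fin k) ℝ) :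
    (Nmat x α w C).det = (Mmat x).det * (Smat (α - 1) w C).det := by
  let E : Matrix (Fin n) (Unit ⊕ Fin k) ℝ :=
    of fun i p => Sum.elim (fun _ => if i = i₀ then 1 else 0) (fun _ => 0) p
  have hcol : ∀ i, Mmat x i i₀ = 1 := fun i => by
    by_cases hi : i = i₀ <;> simp [Mmat, hi, h1]
  have hrow : ∀ i, Mmat x i₀ i = 1 := fun i => by
    by_cases hi : i₀ = i
    · simp [Mmat, ← hi, h1]
    · simp [Mmat, hi]
  have hN : (Nmat x α w C).submatrix (Equiv.sumAssoc _ _ _).symm (Equiv.sumAssoc _ _ _).symm =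
      fromBlocks (Mmat x) (Mmat x * E) (Eᵀ * Mmat x) (Smat α w C) := by
    ext (i | i | i) (j | j | j) <;> simp [Nmat, Smat, E, mul_apply, hcol, hrow] <;> rfl
  have hS : Smat α w C - Eᵀ * Mmat x * E = Smat (α - 1) w C := by
    ext (i | i) (j | j) <;> simp [Smat, E, mul_apply, hrow] <;> rfl
  rw [← det_submatrix_equiv_self (Equiv.sumAssoc _ _ _).symm, hN, det_fromBlocks_mul_mul, hS]

/-- if exactly one of the `x i` equals `1` (the one with index `i₀`), then
`det N = det M * det [[α - 1, wᵀ],[w, C]]`; in particular `N` is nonsingular iff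
`[[α - 1, wᵀ],[w, C]]` is. -/
theorem stmt_11 {n : ℕ} (x : Fin n → ℝ) (i₀ : Fin n)
    (h1 : x i₀ = 1) (h2 : ∀ i, i ≠ i₀ → x i ≠ 1)
    (α : ℝ) {k : ℕ} (w : Fin k → ℝ) (C : Matrix (Fin k) (Fin k) ℝ) :
    (Nmat x α w C).det = (Mmat x).det * (Smat (α - 1) w C).det ∧
      ((Nmat x α w C).det ≠ 0 ↔ (Smat (α - 1) w C).det ≠ 0) := by
  have hN := det_Nmat x i₀ h1 α w C
  refine ⟨hN, ?_⟩
  simp [hN, det_Mmat_ne_zero x i₀ h1 h2]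
end

section
/- Let m ≥ 3, let A(K_{m−1}) = J_{m−1} − I_{m−1} be the adjacency matrix of the complete graph on m−1 vertices, and let N = [[A(K_{m−1}), j, O],[jᵀ, 0, wᵀ],[O, w, C]] for a vector w ∈ ℝ^k and a k×k real matrix C. Then rank N = (m−1) + rank([[−(m−1)/(m−2), wᵀ],[w, C]]). In particular, N is nonsingular if and only if the (k+1)×(k+1) matrix [[−(m−1)/(m−2), wᵀ],[w, C]] is nonsingular. -/
open Matrix BigOperators

/-- The adjacency matrix of the complete graph `K_m`: zeros on the diagonal some ones
elsewhere. -/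
def adjK (m : ℕ) : Matrix (Fin m) (Fin m) ℝ :=
  Matrix.of fun i j => if i = j then 0 else 1

/-- The block matrix `N = [[A(K_{m-1}), j, O],[jᵀ, 0, wᵀ],[O, w, C]]` associated with a
pendant block `K_m` attached at a cut-vertex. -/
def NmatK (m : ℕ) {k : ℕ} (w : Fin k → ℝ) (C : Matrix (Fin k) (Fin k) ℝ) :
    Matrix ((Fin (m - 1) ⊕ Unit) ⊕ Fin k) ((Fin (m - 1) ⊕ Unit) ⊕ Fin k) ℝ :=
  Matrix.fromBlocks
    (Matrix.fromBlocks (adjK (m - 1)) (fun _ _ => 1) (fun _ _ => 1) (fun _ _ => 0))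
    (Matrix.of fun p (j : Fin k) =>
      Sum.elim (fun _ : Fin (m - 1) => (0 : ℝ)) (fun _ : Unit => w j) p)
    (Matrix.of fun (i : Fin k) p =>
      Sum.elim (fun _ : Fin (m - 1) => (0 : ℝ)) (fun _ : Unit => w i) p)
    C

theorem Submodule.finrank_prod_eq {K V W : Type*} [Field K] [AddCommGroup V] [Module K V]
    [AddCommGroup W] [Module K W] (p : Submodule K V) (q : Submodule K W)
    [Module.Finite K p] [Module.Finite K q] :
    Module.finrank K (p.prod q) = Module.finrank K p + Module.finrank K q := by
  have hinj : Function.Injective (p.subtype.prodMap q.subtype) :=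
    Prod.map_injective.mpr ⟨p.injective_subtype, q.injective_subtype⟩
  rw [← Module.finrank_prod, ← LinearMap.finrank_range_of_inj hinj, LinearMap.range_prodMap,
    p.range_subtype, q.range_subtype]

section SchurRank

variable {K l n : Type*} [Field K] [Fintype l] [Fintype n]

theorem rank_fromBlocks_diagonal (A : Matrix l l K) (D : Matrix n n K) :
    (Matrix.fromBlocks A 0 0 D).rank = A.rank + D.rank := by
  have h : (LinearEquiv.sumArrowLequivProdArrow l n K K).toLinearMap ∘ₗ
      (Matrix.fromBlocks A 0 0 D).mulVecLin =
      (A.mulVecLin.prodMap D.mulVecLin) ∘ₗ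
        (LinearEquiv.sumArrowLequivProdArrow l n K K).toLinearMap := by
    refine LinearMap.ext fun x => Prod.ext (funext fun i => ?_) (funext fun i => ?_)
    · simp [Matrix.fromBlocks_mulVec]
      rfl
    · simp [Matrix.fromBlocks_mulVec]
      rfl
  have h' := congrArg LinearMap.range h
  rw [LinearMap.range_comp, LinearEquiv.range_comp, LinearMap.range_prodMap] at h'
  rw [Matrix.rank, ← LinearEquiv.finrank_map_eq (LinearEquiv.sumArrowLequivProdArrow l n K K), h',
    Submodule.finrank_prod_eq, Matrix.rank, Matrix.rank]

variable [DecidableEq l] [DecidableEq n]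

/-- Guttman rank additivity for a block matrix with invertible top-left corner. -/
theorem rank_fromBlocks_of_mul_eq_one {A A' : Matrix l l K} (h : A * A' = 1) (B : Matrix l n K)
    (C : Matrix n l K) (D : Matrix n n K) :
    (Matrix.fromBlocks A B C D).rank = Fintype.card l + (D - C * A' * B).rank := by
  let : Invertible A := ⟨A', mul_eq_one_comm.mp h, h⟩
  rw [Matrix.fromBlocks_eq_of_invertible₁₁,
    Matrix.rank_mul_eq_left_of_isUnit_det _ _ (by simp),
    Matrix.rank_mul_eq_right_of_isUnit_det _ _ (by simp), rank_fromBlocks_diagonal,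
    Matrix.rank_of_isUnit A (isUnit_of_invertible A), invOf_eq_right_inv h]

theorem det_ne_zero_iff_rank_eq_card (A : Matrix n n K) :
    A.det ≠ 0 ↔ A.rank = Fintype.card n := by
  refine ⟨Matrix.rank_of_det_ne_zero, fun h => ?_⟩
  rw [← isUnit_iff_ne_zero, ← Matrix.isUnit_iff_isUnit_det, ← Matrix.mulVec_surjective_iff_isUnit]
  have : LinearMap.range A.mulVecLin = ⊤ :=
    Submodule.eq_top_of_finrank_eq (by simpa [Matrix.rank] using h)
  exact LinearMap.range_eq_top.mp this

end SchurRank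

theorem adjK_eq (n : ℕ) : adjK n = Matrix.of (fun _ _ => 1) - 1 := by
  ext i j
  by_cases h : i = j <;> simp [adjK, h]

/-- The inverse of `J - I` of size `n ≥ 2` is `J / (n - 1) - I`. -/
theorem adjK_mul_inverse {n : ℕ} (hn : 2 ≤ n) :
    adjK n * (Matrix.of (fun _ _ => ((n : ℝ) - 1)⁻¹) - 1) = 1 := by
  have hn' : (n : ℝ) - 1 ≠ 0 := by
    have : (2 : ℝ) ≤ n := by exact_mod_cast hn
    linarith
  rw [adjK_eq, sub_mul, mul_sub, one_mul, mul_one]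
  ext i j
  simp [Matrix.mul_apply]
  field_simp
  ring

/-- After reassociating the index type, `NmatK` has `adjK (m - 1)` as its top-left block. -/
theorem NmatK_eq_submatrix (m : ℕ) {k : ℕ} (w : Fin k → ℝ) (C : Matrix (Fin k) (Fin k) ℝ) :
    NmatK m w C = (Matrix.fromBlocks (adjK (m - 1))
      (Matrix.of fun _ => Sum.elim (fun _ => 1) 0) (Matrix.of (Sum.elim (fun _ _ => 1) 0))
      (Smat 0 w C)).submatrix (Equiv.sumAssoc _ _ _) (Equiv.sumAssoc _ _ _) := by
  ext ((i | i) | i) ((j | j) | j) <;> simp [NmatK, Smat, Matrix.fromBlocks]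

theorem rank_NmatK {m : ℕ} (hm : 3 ≤ m) {k : ℕ} (w : Fin k → ℝ)
    (C : Matrix (Fin k) (Fin k) ℝ) :
    (NmatK m w C).rank =
      (m - 1) + (Smat (-(((m : ℝ) - 1) / ((m : ℝ) - 2))) w C).rank := by
  rw [NmatK_eq_submatrix, Matrix.rank_submatrix,
    rank_fromBlocks_of_mul_eq_one (adjK_mul_inverse (by omega)), Fintype.card_fin]
  congr 2
  have hm' : (m : ℝ) - 2 ≠ 0 := by
    have : (3 : ℝ) ≤ m := by exact_mod_cast hm
    linarith
  have hcast : ((m - 1 : ℕ) : ℝ) = m - 1 := by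
    rw [Nat.cast_sub (by omega), Nat.cast_one]
  have hsub : (m : ℝ) - 1 - 1 = m - 2 := by ring
  ext (i | i) (j | j) <;>
    simp [Smat, Matrix.fromBlocks, Matrix.mul_apply, Matrix.mul_sub, hcast, hsub]
  field_simp
  ring

/-- for `m ≥ 3`,
`rank N = (m-1) + rank [[-(m-1)/(m-2), wᵀ],[w, C]]`; in particular `N` is nonsingular iff
`[[-(m-1)/(m-2), wᵀ],[w, C]]` is nonsingular. -/
theorem stmt_14 {m : ℕ} (hm : 3 ≤ m) {k : ℕ} (w : Fin k → ℝ)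
    (C : Matrix (Fin k) (Fin k) ℝ) :
    (NmatK m w C).rank =
        (m - 1) + (Smat (-(((m : ℝ) - 1) / ((m : ℝ) - 2))) w C).rank ∧
      ((NmatK m w C).det ≠ 0 ↔
        (Smat (-(((m : ℝ) - 1) / ((m : ℝ) - 2))) w C).det ≠ 0) := by
  have h := rank_NmatK hm w C
  refine ⟨h, ?_⟩
  rw [det_ne_zero_iff_rank_eq_card, det_ne_zero_iff_rank_eq_card, h]
  simp only [Fintype.card_sum, Fintype.card_fin, Fintype.card_unit]
  omega
end
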